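/- For every natural number n, the squared norm of the Koornwinder polynomial with respect to the point-mass inner product has the closed form (1/2)·∫_{−1}^{1} K_n(s)² ds + K_n(1)² = (n²+1)·((n+1)²+1)/(2n+1). -/

import Mathlib

open Polynomial

/-- The `n`-th Legendre polynomial (over `ℝ`), normalized so that `legendre n` evaluates
to `1` at `1`, defined via Rodrigues' formula. -/
noncomputable def legendre (n : ℕ) : Polynomial ℝ :=
  ((1 : ℝ) / (2 ^ n * n.factorial)) • derivative^[n] ((X ^ 2 - 1) ^ n)

/-- The `n`-th Koornwinder polynomial `K_n(s) = -(1+s) L_n'(s) + (n² + n + 1) L_n(s)`. -/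
noncomputable def koornwinder (n : ℕ) : Polynomial ℝ :=
  -(1 + X) * derivative (legendre n) + ((n : ℝ) ^ 2 + (n : ℝ) + 1) • legendre n



theorem dit (k : ℕ) (f : ℝ[X]) : derivative (derivative^[k] f) = derivative^[k+1] f :=
  (Function.iterate_succ_apply' _ _ _).symm

theorem C_two : (C (2:ℝ) : ℝ[X]) = 2 := map_ofNat C 2

theorem C_three : (C (3:ℝ) : ℝ[X]) = 3 := map_ofNat C 3

theorem iter_deriv_X_mul (k : ℕ) (f : Polynomial ℝ) :
    derivative^[k+1] (X * f) = X * derivative^[k+1] f + ((k : ℝ[X]) + 1) * derivative^[k] f := by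
  induction k with
  | zero => simp; ring
  | succ k ih =>
    rw [Function.iterate_succ_apply', ih]
    simp only [derivative_add, derivative_mul, derivative_X, Function.iterate_succ_apply',
      derivative_natCast, derivative_one]
    push_cast
    ring

theorem deriv_u (n : ℕ) : derivative ((X ^ 2 - 1 : ℝ[X]) ^ (n+1))
    = (2 * ((n : ℝ) + 1)) • (X * (X ^ 2 - 1) ^ n) := by
  rw [derivative_pow_succ]
  simp [smul_eq_C_mul, C_two]
  ring

theorem coef_succ (n : ℕ) : (1 : ℝ) / (2 ^ (n+1) * (n+1).factorial) * (2 * ((n : ℝ) + 1))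
    = 1 / (2 ^ n * n.factorial) := by
  have : ((n.factorial : ℕ) : ℝ) ≠ 0 := by exact_mod_cast n.factorial_ne_zero
  have h2 : (n : ℝ) + 1 ≠ 0 := by positivity
  rw [Nat.factorial_succ]
  push_cast
  field_simp
  ring

theorem leg_rec1 (n : ℕ) : derivative (legendre (n+1))
    = ((n : ℝ[X]) + 1) * legendre n + X * derivative (legendre n) := by
  unfold legendre
  rw [derivative_smul, derivative_smul, dit, dit, Function.iterate_succ_apply, deriv_u,
    iterate_derivative_smul, smul_smul, coef_succ, iter_deriv_X_mul]
  simp only [smul_eq_C_mul]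
  ring

theorem leg_rec2 (n : ℕ) : derivative (legendre n)
    = X * derivative (legendre (n+1)) - ((n : ℝ[X]) + 1) * legendre (n+1) := by
  have h : X * derivative ((X ^ 2 - 1 : ℝ[X]) ^ (n+1))
      = (2 * ((n : ℝ) + 1)) • ((X ^ 2 - 1) ^ (n+1) + (X ^ 2 - 1) ^ n) := by
    rw [deriv_u]; simp only [smul_eq_C_mul]; ring
  have h2 := congrArg (fun p => derivative^[n+1] p) h
  simp only [iter_deriv_X_mul, iterate_derivative_smul, iterate_map_add,
    ← Function.iterate_succ_apply] at h2
  have h3 := congrArg (fun p => ((1 : ℝ) / (2 ^ (n+1) * (n+1).factorial)) • p) h2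
  have h4 : C ((1 : ℝ) / (2 ^ n * n.factorial))
      = C ((1 : ℝ) / (2 ^ (n+1) * (n+1).factorial)) * (2 * ((n : ℝ[X]) + 1)) := by
    rw [← coef_succ, C_mul]; simp [C_two]
  unfold legendre
  rw [derivative_smul, derivative_smul, dit, dit]
  simp only [smul_eq_C_mul] at h3 ⊢
  have h5 : (C (2 * ((n : ℝ) + 1))) = 2 * ((n : ℝ[X]) + 1) := by simp [C_two]
  rw [h5] at h3
  rw [h4]
  try simp only [Nat.succ_eq_add_one] at h3
  linear_combination -h3

theorem leg_rec3 (n : ℕ) : ((n : ℝ[X]) + 1) * legendre (n+1)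
    = ((n : ℝ[X]) + 1) * X * legendre n - (1 - X ^ 2) * derivative (legendre n) := by
  linear_combination leg_rec2 n + X * leg_rec1 n

theorem leg_ode (n : ℕ) : (1 - X ^ 2) * derivative (derivative (legendre n))
    = 2 * X * derivative (legendre n) - (n : ℝ[X]) * ((n : ℝ[X]) + 1) * legendre n := by
  have h := congrArg derivative (leg_rec3 n)
  simp only [derivative_mul, derivative_add, derivative_sub, derivative_natCast, derivative_one,
    derivative_X, derivative_X_pow] at h
  simp [C_two] at h
  linear_combination h - ((n : ℝ[X]) + 1) * leg_rec1 n

theorem leg_one (n : ℕ) : (legendre n).eval 1 = 1 := by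
  induction n with
  | zero => simp [legendre]
  | succ n ih =>
    have h := congrArg (eval 1) (leg_rec3 n)
    simp [ih] at h
    have h2 : (n : ℝ) + 1 ≠ 0 := by positivity
    exact mul_left_cancel₀ h2 (by linarith)

theorem leg_neg_one_succ (n : ℕ) : (legendre (n+1)).eval (-1) = - (legendre n).eval (-1) := by
  have h := congrArg (eval (-1)) (leg_rec3 n)
  simp at h
  have h2 : (n : ℝ) + 1 ≠ 0 := by positivity
  exact mul_left_cancel₀ h2 (by linarith)

theorem leg_neg_one_sq (n : ℕ) : (legendre n).eval (-1) ^ 2 = 1 := by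
  induction n with
  | zero => simp [legendre]
  | succ n ih => rw [leg_neg_one_succ, neg_sq, ih]

theorem int_deriv (p : ℝ[X]) : ∫ s in (-1 : ℝ)..1, (derivative p).eval s
    = p.eval 1 - p.eval (-1) :=
  intervalIntegral.integral_eq_sub_of_hasDerivAt (fun x _ => p.hasDerivAt x)
    ((derivative p).continuous.intervalIntegrable _ _)

theorem int_add (p q : ℝ[X]) : ∫ s in (-1 : ℝ)..1, (p + q).eval s
    = (∫ s in (-1 : ℝ)..1, p.eval s) + ∫ s in (-1 : ℝ)..1, q.eval s := by
  simp only [eval_add]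
  exact intervalIntegral.integral_add (p.continuous.intervalIntegrable _ _)
    (q.continuous.intervalIntegrable _ _)

theorem int_C_mul (a : ℝ) (p : ℝ[X]) : ∫ s in (-1 : ℝ)..1, (C a * p).eval s
    = a * ∫ s in (-1 : ℝ)..1, p.eval s := by
  simp only [eval_mul, eval_C]
  exact intervalIntegral.integral_const_mul _ _

theorem leg_norm (n : ℕ) : ∫ s in (-1 : ℝ)..1, (legendre n ^ 2).eval s = 2 / (2 * n + 1) := by
  induction n with
  | zero => simp [legendre]; norm_num
  | succ n ih =>
    have key : C (2 * (n : ℝ) + 3) * legendre (n+1) ^ 2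
        = C (2 * (n : ℝ) + 1) * legendre n ^ 2 +
          derivative (X * legendre n ^ 2 + X * legendre (n+1) ^ 2
            - 2 * (legendre n * legendre (n+1))) := by
      simp [derivative_mul, derivative_pow, C_two, C_three]
      linear_combination (2 * legendre n) * leg_rec1 n + (2 * legendre (n+1)) * leg_rec2 n
    have h := congrArg (fun p : ℝ[X] => ∫ s in (-1 : ℝ)..1, p.eval s) key
    simp only [int_add, int_C_mul, int_deriv, ih] at h
    simp [leg_one, leg_neg_one_succ] at h
    have h1 := leg_neg_one_sq n
    have e : (legendre n).eval (-1) * (legendre n).eval (-1) = 1 := by rw [← sq, h1]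
    simp [h1, e] at h
    have p1 : 2 * (n : ℝ) + 1 ≠ 0 := by positivity
    have p3 : 2 * (n : ℝ) + 3 ≠ 0 := by positivity
    push_cast
    rw [eq_div_iff (by positivity)]
    field_simp at h
    simp only [eval_pow]
    linarith

theorem koorn_sq (n : ℕ) : koornwinder n ^ 2
    = derivative ((X + 1) * (1 - X ^ 2) * derivative (legendre n) ^ 2
        - (1 + X) * legendre n ^ 2)
      + C (((n : ℝ) ^ 2 + n + 1) ^ 2 + 1) * legendre n ^ 2 := by
  unfold koornwinder
  simp [derivative_mul, derivative_pow, C_two, smul_eq_C_mul]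
  linear_combination (-2 * (X + 1) * derivative (legendre n)) * leg_ode n

theorem koorn_one (n : ℕ) : (koornwinder n).eval 1 = 1 := by
  have h := congrArg (eval 1) (leg_ode n)
  simp [leg_one] at h
  simp [koornwinder, leg_one]
  linarith

open MeasureTheory intervalIntegral in
/-- Closed-form expression of the squared norm of the Koornwinder polynomial for the inner
product with a point mass at `1`:
`(1/2)∫_{-1}^1 K_n² ds + K_n(1)² = (n²+1)((n+1)²+1)/(2n+1)`. -/
theorem koornwinder_normSq (n : ℕ) :
    (1 / 2) * (∫ s in (-1 : ℝ)..1, (koornwinder n).eval s ^ 2)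
      + (koornwinder n).eval 1 ^ 2
    = (((n : ℝ) ^ 2 + 1) * (((n : ℝ) + 1) ^ 2 + 1)) / (2 * (n : ℝ) + 1) := by
  have h := congrArg (fun p : ℝ[X] => ∫ s in (-1 : ℝ)..1, p.eval s) (koorn_sq n)
  simp only [int_add, int_C_mul, int_deriv, leg_norm] at h
  simp [leg_one] at h
  rw [h, koorn_one]
  field_simp
  ring
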